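/- For every integer k ≥ 1, the class of D_k-free chordal bipartite finite graphs admits an implicit representation, where D_k is the graph obtained from a 4-cycle with vertices v₁, v₂, v₃, v₄ (in cyclic order) by adding one pendant vertex adjacent only to v₁, one pendant vertex adjacent only to v₂, and k pendant vertices each adjacent only to v₄. -/

import Mathlib

open SimpleGraph

/-- `D_k`: the 4-cycle `v₁v₂v₃v₄` (vertices `inl 0, inl 1, inl 2, inl 3` in cyclic
order) together with a pendant vertex `inr (inl 0)` adjacent only to `v₁`, a pendant
vertex `inr (inl 1)` adjacent only to `v₂`, and `k` pendant vertices `inr (inr j)`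
each adjacent only to `v₄`. -/
def Dgraph (k : ℕ) : SimpleGraph (Fin 4 ⊕ (Fin 2 ⊕ Fin k)) :=
  SimpleGraph.fromRel fun u v =>
    match u, v with
    | Sum.inl a, Sum.inl b => ((a : ℕ), (b : ℕ)) ∈ [(0,1),(1,2),(2,3),(3,0)]
    | Sum.inl a, Sum.inr (Sum.inl c) => (a = 0 ∧ c = 0) ∨ (a = 1 ∧ c = 1)
    | Sum.inl a, Sum.inr (Sum.inr _) => a = 3
    | _, _ => False

/-- Chordal bipartite: bipartite with no induced cycle of length 6 or more. -/
def ChordalBipartite {V : Type*} (G : SimpleGraph V) : Prop :=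
  G.Colorable 2 ∧ ∀ m : ℕ, 6 ≤ m → ¬ Nonempty (SimpleGraph.cycleGraph m ↪g G)

/-- A class of finite simple graphs, given by its members on the concrete
vertex sets `Fin n`. -/
abbrev GraphClass : Type := ∀ n : ℕ, SimpleGraph (Fin n) → Prop

/-- A class `C` admits an implicit representation. -/
def AdmitsImplicit (C : GraphClass) : Prop :=
  ∃ (c : ℕ) (D : ℕ → ℕ → Prop),
    ∀ n : ℕ, 2 ≤ n → ∀ G : SimpleGraph (Fin n), C n G →
      ∃ ℓ : Fin n → Fin (n ^ c), Function.Injective ℓ ∧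
        ∀ u v : Fin n, u ≠ v → (G.Adj u v ↔ D (ℓ u).val (ℓ v).val)


/-! ### Encoding tuples -/

def encTuple : (m : ℕ) → (Fin m → ℕ) → ℕ
  | 0, _ => 0
  | m + 1, f => Nat.pair (f 0) (encTuple m (fun i => f i.succ))

theorem encTuple_lt (N : ℕ) (hN : 1 ≤ N) : ∀ (m : ℕ) (f : Fin m → ℕ), (∀ i, f i < N) →
    encTuple m f < N ^ (2 ^ m)
  | 0, f, _ => by simp [encTuple]; omega
  | m + 1, f, h => by
    have ih := encTuple_lt N hN m (fun i => f i.succ) (fun i => h _)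
    have h0 := h 0
    simp only [encTuple]
    refine lt_of_lt_of_le (Nat.pair_lt_max_add_one_sq _ _) ?_
    have h1 : N ≤ N ^ (2 ^ m) := Nat.le_self_pow (by positivity) N
    rw [pow_succ 2 m, pow_mul]
    refine Nat.pow_le_pow_left ?_ 2
    have : max (f 0) (encTuple m (fun i => f i.succ)) < N ^ 2 ^ m :=
      max_lt (lt_of_lt_of_le h0 h1) ih
    omega

theorem encTuple_inj : ∀ (m : ℕ) (f g : Fin m → ℕ), encTuple m f = encTuple m g → f = g
  | 0, f, g, _ => by funext i; exact i.elim0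
  | m + 1, f, g, h => by
    simp only [encTuple, Nat.pair_eq_pair] at h
    have ih := encTuple_inj m _ _ h.2
    funext i
    refine Fin.cases h.1 (fun j => ?_) i
    exact congrFun ih j

theorem admits_of_tuples {ι : Type} [Fintype ι] (R : (ι → ℕ) → (ι → ℕ) → Prop)
    (C : GraphClass)
    (h : ∀ n : ℕ, 2 ≤ n → ∀ G : SimpleGraph (Fin n), C n G →
      ∃ f : Fin n → ι → ℕ, Function.Injective f ∧ (∀ u i, f u i ≤ n) ∧
        ∀ u v, u ≠ v → (G.Adj u v ↔ R (f u) (f v))) : AdmitsImplicit C := by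
  classical
  let e := Fintype.equivFin ι
  let m := Fintype.card ι
  refine ⟨2 * 2 ^ m, fun x y => ∃ f g : ι → ℕ, x = encTuple m (fun i => f (e.symm i)) ∧
    y = encTuple m (fun i => g (e.symm i)) ∧ R f g, fun n hn G hG => ?_⟩
  obtain ⟨f, hinj, hle, hadj⟩ := h n hn G hG
  have key : ∀ f g : ι → ℕ, encTuple m (fun i => f (e.symm i)) =
      encTuple m (fun i => g (e.symm i)) → f = g := by
    intro f g hfg
    have := encTuple_inj m _ _ hfg
    funext i
    simpa using congrFun this (e i)
  refine ⟨fun u => ⟨encTuple m (fun i => f u (e.symm i)), ?_⟩, ?_, ?_⟩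
  · rw [pow_mul]
    refine encTuple_lt _ (Nat.one_le_pow _ _ (by omega)) m _ (fun i => ?_)
    have := hle u (e.symm i)
    nlinarith
  · intro u v huv
    exact hinj (key _ _ (by simpa using huv))
  · intro u v huv
    rw [hadj u v huv]
    constructor
    · intro hR
      exact ⟨f u, f v, rfl, rfl, hR⟩
    · rintro ⟨a, b, ha, hb, hR⟩
      rw [key _ _ ha, key _ _ hb]
      exact hR

/-! ### Laminar families are intervals -/

theorem laminar_intervals {V : Type} [Fintype V] [DecidableEq V] :
    ∀ (N : ℕ) (M : Finset (Finset V)), M.card = N → (∀ A ∈ M, A.Nonempty) →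
    (∀ A ∈ M, ∀ B ∈ M, Disjoint A B ∨ A ⊆ B ∨ B ⊆ A) →
    ∃ L : V → ℕ, Function.Injective L ∧ ∀ B ∈ M, ∃ l h, ∀ v, v ∈ B ↔ l ≤ L v ∧ L v ≤ h := by
  intro N
  induction N with
  | zero =>
    intro M hM _ _
    refine ⟨fun v => (Fintype.equivFin V v : ℕ), ?_, ?_⟩
    · intro u v h
      exact (Fintype.equivFin V).injective (Fin.ext h)
    · simp [Finset.card_eq_zero.mp hM]
  | succ N ih =>
    intro M hM hne hlam
    have hMne : M.Nonempty := by
      rw [← Finset.card_pos]; omega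
    obtain ⟨A, hA⟩ := M.exists_minimal hMne
    have hAM := hA.prop
    obtain ⟨L, hLinj, hL⟩ := ih (M.erase A) (by rw [Finset.card_erase_of_mem hAM]; omega)
      (fun B hB => hne B (Finset.mem_of_mem_erase hB))
      (fun B hB C hC => hlam B (Finset.mem_of_mem_erase hB) C (Finset.mem_of_mem_erase hC))
    obtain ⟨a, ha⟩ := hne A hAM
    let n := Fintype.card V
    let idx : V → ℕ := fun v => (Fintype.equivFin V v : ℕ)
    have hidx : ∀ v, idx v < n := fun v => (Fintype.equivFin V v).2
    have hidxinj : ∀ u v, idx u = idx v → u = v := by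
      intro u v h
      exact (Fintype.equivFin V).injective (Fin.ext h)
    let L1 : V → ℕ := fun v => if v ∈ A then L a else L v
    have hn : 0 < n := Fintype.card_pos_iff.mpr ⟨a⟩
    have hdiv : ∀ v, (n * L1 v + idx v) / n = L1 v := by
      intro v
      rw [Nat.mul_add_div hn, Nat.div_eq_of_lt (hidx v)]; rfl
    have hcond : ∀ l h v, (n * l ≤ n * L1 v + idx v ∧ n * L1 v + idx v ≤ n * h + (n - 1)) ↔
        (l ≤ L1 v ∧ L1 v ≤ h) := by
      intro l h v
      have e1 : n * l ≤ n * L1 v + idx v ↔ l ≤ L1 v := by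
        conv_rhs => rw [← hdiv v]
        rw [Nat.le_div_iff_mul_le hn, mul_comm]
      have e2 : n * L1 v + idx v ≤ n * h + (n - 1) ↔ L1 v ≤ h := by
        conv_rhs => rw [← hdiv v]
        rw [← Nat.lt_succ_iff (n := h), Nat.div_lt_iff_lt_mul hn, Nat.succ_mul, mul_comm h n]
        omega
      rw [e1, e2]
    refine ⟨fun v => n * L1 v + idx v, ?_, ?_⟩
    · intro u v huv
      apply hidxinj
      have h1 : (n * L1 u + idx u) / n = (n * L1 v + idx v) / n := by
        simp only at huv; rw [huv]
      rw [hdiv, hdiv] at h1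
      simp only [h1] at huv
      omega
    · intro B hB
      by_cases hBA : B = A
      · subst hBA
        refine ⟨n * L a, n * L a + (n - 1), fun v => ?_⟩
        rw [hcond]
        by_cases hv : v ∈ B
        · simp [L1, hv]
        · simp only [L1, hv, if_false, false_iff]
          intro h
          exact hv ((hLinj (le_antisymm h.2 h.1)) ▸ ha)
      · obtain ⟨l, h, hlh⟩ := hL B (Finset.mem_erase.mpr ⟨hBA, hB⟩)
        refine ⟨n * l, n * h + (n - 1), fun v => ?_⟩
        rw [hcond]
        by_cases hv : v ∈ A
        · simp only [L1, hv, if_true]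
          rw [← hlh a]
          rcases hlam A hAM B hB with hd | hs | hs
          · have h1 := Finset.disjoint_left.mp hd hv
            have h2 := Finset.disjoint_left.mp hd ha
            simp [h1, h2]
          · simp [hs hv, hs ha]
          · exact absurd (Finset.Subset.antisymm hs (hA.le_of_le hB hs)) hBA
        · simp only [L1, hv, if_false]
          exact hlh v

theorem laminar_ranks {V : Type} [Fintype V] [DecidableEq V] (M : Finset (Finset V))
    (hne : ∀ A ∈ M, A.Nonempty)
    (hlam : ∀ A ∈ M, ∀ B ∈ M, Disjoint A B ∨ A ⊆ B ∨ B ⊆ A) :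
    ∃ pos : V → ℕ, Function.Injective pos ∧ (∀ v, pos v < Fintype.card V) ∧
      ∀ B ∈ M, ∃ l h, l ≤ Fintype.card V ∧ h ≤ Fintype.card V ∧
        ∀ v, v ∈ B ↔ l ≤ pos v ∧ pos v < h := by
  obtain ⟨L, hinj, hL⟩ := laminar_intervals _ M rfl hne hlam
  let pos : V → ℕ := fun v => (Finset.univ.filter (fun u => L u < L v)).card
  have hmono : ∀ u v, L u < L v → pos u < pos v := by
    intro u v huv
    apply Finset.card_lt_card
    refine Finset.ssubset_iff_subset_ne.mpr ⟨fun x hx => ?_, fun h => ?_⟩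
    · simp only [Finset.mem_filter, Finset.mem_univ, true_and] at hx ⊢; omega
    · have : u ∈ Finset.univ.filter (fun x => L x < L u) := by rw [h]; simpa using huv
      simp at this
  refine ⟨pos, ?_, ?_, ?_⟩
  · intro u v huv
    by_contra hne
    rcases lt_trichotomy (L u) (L v) with h | h | h
    · have := hmono _ _ h; omega
    · exact hne (hinj h)
    · have := hmono _ _ h; omega
  · intro v
    apply Finset.card_lt_univ_of_notMem (x := v)
    simp
  · intro B hB
    obtain ⟨l, h, hlh⟩ := hL B hB
    refine ⟨(Finset.univ.filter (fun u => L u < l)).card,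
      (Finset.univ.filter (fun u => L u ≤ h)).card, Finset.card_le_univ _,
      Finset.card_le_univ _, fun v => ?_⟩
    rw [hlh v]
    refine and_congr ⟨fun hl => ?_, fun hl => ?_⟩ ⟨fun hl => ?_, fun hl => ?_⟩
    · apply Finset.card_le_card
      intro x hx
      simp only [Finset.mem_filter, Finset.mem_univ, true_and] at hx ⊢; omega
    · by_contra hcon
      have : pos v < (Finset.univ.filter (fun u => L u < l)).card := by
        apply Finset.card_lt_card
        refine Finset.ssubset_iff_subset_ne.mpr ⟨fun x hx => ?_, fun h => ?_⟩
        · simp only [Finset.mem_filter, Finset.mem_univ, true_and] at hx ⊢; omega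
        · have : v ∈ Finset.univ.filter (fun x => L x < L v) := by
            rw [h]; simp; omega
          simp at this
      omega
    · apply Finset.card_lt_card
      refine Finset.ssubset_iff_subset_ne.mpr ⟨fun x hx => ?_, fun h => ?_⟩
      · simp only [Finset.mem_filter, Finset.mem_univ, true_and] at hx ⊢; omega
      · have : v ∈ Finset.univ.filter (fun x => L x < L v) := by
          rw [h]; simpa using hl
        simp at this
    · by_contra hcon
      have : (Finset.univ.filter (fun u => L u ≤ h)).card ≤ pos v := by
        apply Finset.card_le_card
        intro x hx
        simp only [Finset.mem_filter, Finset.mem_univ, true_and] at hx ⊢; omega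
      omega

/-! ### Almost laminar families -/

def AlmostLaminar {V : Type} [DecidableEq V] (k : ℕ) (F : V → Finset V) : Prop :=
  ∀ s t w, w ∈ F s → w ∈ F t → F s ⊆ F t ∨ F t ⊆ F s ∨
    ((F s \ F t).card < k ∧ (F t \ F s).card < k)

def famRel (k : ℕ) (x y : Fin 3 ⊕ Fin (2 * k) → ℕ) : Prop :=
  ¬ ((x (Sum.inl 1) ≤ y (Sum.inl 0) ∧ y (Sum.inl 0) < x (Sum.inl 2)) ↔
    ∃ j, x (Sum.inr j) = y (Sum.inl 0))

theorem almostLaminar_rep {V : Type} [Fintype V] [DecidableEq V] (k : ℕ) (F : V → Finset V)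
    (hF : AlmostLaminar k F) :
    ∃ f : V → (Fin 3 ⊕ Fin (2 * k)) → ℕ, Function.Injective f ∧
      (∀ u i, f u i ≤ Fintype.card V) ∧ ∀ u v, v ∈ F u ↔ famRel k (f u) (f v) := by
  classical
  let P : Finset (Finset V) → Prop := fun M =>
    (∀ A ∈ M, A.Nonempty ∧ ∃ s, F s = A) ∧
      ∀ A ∈ M, ∀ B ∈ M, Disjoint A B ∨ A ⊆ B ∨ B ⊆ A
  obtain ⟨M, hM⟩ := (Finset.univ.filter P).exists_maximal ⟨∅, by simp [P]⟩
  have hMP : P M := by simpa using hM.prop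
  obtain ⟨pos, hinj, hpos, hInter⟩ := laminar_ranks M (fun A hA => (hMP.1 A hA).1) hMP.2
  have main : ∀ u, ∃ (l h : ℕ) (X : Finset V), l ≤ Fintype.card V ∧ h ≤ Fintype.card V ∧
      X.card ≤ 2 * k ∧ ∀ v, v ∈ F u ↔ ¬ ((l ≤ pos v ∧ pos v < h) ↔ v ∈ X) := by
    intro u
    by_cases hu : F u = ∅
    · exact ⟨0, 0, ∅, by simp, by simp, by simp, fun v => by simp [hu]⟩
    have hune := Finset.nonempty_iff_ne_empty.mpr hu
    have : ∃ A ∈ M, (A \ F u).card ≤ k ∧ (F u \ A).card ≤ k := by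
      by_cases huM : F u ∈ M
      · exact ⟨F u, huM, by simp, by simp⟩
      by_contra hcon
      push Not at hcon
      have hlamu : ∀ A ∈ M, Disjoint A (F u) ∨ A ⊆ F u ∨ F u ⊆ A := by
        intro A hA
        obtain ⟨s, hs⟩ := (hMP.1 A hA).2
        by_cases hd : Disjoint A (F u)
        · exact Or.inl hd
        obtain ⟨w, hw1, hw2⟩ := Finset.not_disjoint_iff.mp hd
        subst hs
        rcases hF s u w hw1 hw2 with h | h | h
        · exact Or.inr (Or.inl h)
        · exact Or.inr (Or.inr h)
        · have := hcon _ hA h.1.le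
          omega
      have hP : P (insert (F u) M) := by
        refine ⟨?_, ?_⟩
        · intro A hA
          rcases Finset.mem_insert.mp hA with rfl | hA
          · exact ⟨hune, u, rfl⟩
          · exact hMP.1 A hA
        · intro A hA B hB
          rcases Finset.mem_insert.mp hA with rfl | hA
          · rcases Finset.mem_insert.mp hB with rfl | hB
            · exact Or.inr (Or.inl (Finset.Subset.refl _))
            · rcases hlamu B hB with h | h | h
              · exact Or.inl h.symm
              · exact Or.inr (Or.inr h)
              · exact Or.inr (Or.inl h)
          · rcases Finset.mem_insert.mp hB with rfl | hB
            · exact hlamu A hA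
            · exact hMP.2 A hA B hB
      have := hM.le_of_ge (by simpa using hP) (Finset.subset_insert _ _)
      exact huM (this (Finset.mem_insert_self _ _))
    obtain ⟨A, hA, h1, h2⟩ := this
    obtain ⟨l, h, hl, hh, hlh⟩ := hInter A hA
    refine ⟨l, h, (A \ F u) ∪ (F u \ A), hl, hh, ?_, fun v => ?_⟩
    · exact (Finset.card_union_le _ _).trans (by omega)
    · rw [← hlh v]
      simp only [Finset.mem_union, Finset.mem_sdiff]
      tauto
  choose l h X hl hh hX hmem using main
  let f : V → (Fin 3 ⊕ Fin (2 * k)) → ℕ := fun u i => match i with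
    | Sum.inl 0 => pos u
    | Sum.inl 1 => l u
    | Sum.inl 2 => h u
    | Sum.inr j => ((X u).toList.map pos).getD j (Fintype.card V)
  refine ⟨f, ?_, ?_, ?_⟩
  · intro u v huv
    exact hinj (congrFun huv (Sum.inl 0))
  · intro u i
    rcases i with i | j
    · fin_cases i
      · exact (hpos u).le
      · exact hl u
      · exact hh u
    · show ((X u).toList.map pos).getD j (Fintype.card V) ≤ _
      by_cases hj : (j : ℕ) < ((X u).toList.map pos).length
      · rw [List.getD_eq_getElem _ _ hj, List.getElem_map]
        exact (hpos _).le
      · rw [List.getD_eq_default _ _ (by omega)]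
  · intro u v
    rw [hmem u v]
    have e : (∃ j : Fin (2 * k), f u (Sum.inr j) = f v (Sum.inl 0)) ↔ v ∈ X u := by
      constructor
      · rintro ⟨j, hj⟩
        change ((X u).toList.map pos).getD j (Fintype.card V) = pos v at hj
        by_cases hj' : (j : ℕ) < ((X u).toList.map pos).length
        · rw [List.getD_eq_getElem _ _ hj', List.getElem_map] at hj
          rw [← hinj hj, ← Finset.mem_toList]
          exact List.getElem_mem _
        · rw [List.getD_eq_default _ _ (by omega)] at hj
          have := hpos v
          omega
      · intro hv
        rw [← Finset.mem_toList] at hv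
        obtain ⟨j, hj, hjv⟩ := List.getElem_of_mem hv
        have hlen : (X u).toList.length = (X u).card := Finset.length_toList _
        refine ⟨⟨j, by have := hX u; omega⟩, ?_⟩
        change ((X u).toList.map pos).getD j (Fintype.card V) = pos v
        rw [List.getD_eq_getElem _ _ (by simpa using hj), List.getElem_map, hjv]
    unfold famRel
    rw [e]

/-! ### Induced cycles -/

theorem cycle_embed {V : Type} (G : SimpleGraph V) (m : ℕ) (hm : 3 ≤ m) (c : ℕ → V)
    (hne : ∀ i j, i < j → j < m → c i ≠ c j)
    (hadj : ∀ i j, i < j → j < m → (G.Adj (c i) (c j) ↔ (j = i + 1 ∨ (i = 0 ∧ j = m - 1)))) :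
    Nonempty (SimpleGraph.cycleGraph m ↪g G) := by
  have key : ∀ u v : Fin m, u < v →
      ((SimpleGraph.cycleGraph m).Adj u v ↔ G.Adj (c u) (c v)) := by
    intro u v huv
    have h1 : (v - u).val = v.val - u.val := Fin.sub_val_of_le huv.le
    have h2 : (u - v).val = m + u.val - v.val := Fin.coe_sub_iff_lt.mpr huv
    have huv' : u.val < v.val := huv
    rw [SimpleGraph.cycleGraph_adj', hadj u v huv v.2, h1, h2]
    have := v.2
    omega
  refine ⟨⟨⟨fun i => c i, ?_⟩, ?_⟩⟩
  · intro u v huv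
    rcases lt_trichotomy u v with h | h | h
    · exact absurd huv (hne u v h v.2)
    · exact h
    · exact absurd huv.symm (hne v u h u.2)
  · intro u v
    show G.Adj (c u) (c v) ↔ _
    rcases lt_trichotomy u v with h | h | h
    · exact (key u v h).symm
    · subst h; simp
    · rw [G.adj_comm, (SimpleGraph.cycleGraph m).adj_comm u v]
      exact (key v u h).symm

/-- Graph restricted to a set, on the same vertex type. -/
def restr {V : Type} (G : SimpleGraph V) (S : Set V) : SimpleGraph V where
  Adj u v := G.Adj u v ∧ u ∈ S ∧ v ∈ S
  symm := ⟨fun _ _ h => ⟨h.1.symm, h.2.2, h.2.1⟩⟩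
  loopless := ⟨fun _ h => G.loopless.irrefl _ h.1⟩

/-- A level function (distance to a root in each component). -/
structure IsLevel {V : Type} (G : SimpleGraph V) (lev : V → ℕ) : Prop where
  adj : ∀ u v, G.Adj u v → lev u = lev v + 1 ∨ lev v = lev u + 1
  down : ∀ v, 0 < lev v → ∃ u, G.Adj v u ∧ lev u + 1 = lev v
  root : ∀ u v, G.Reachable u v → lev u = 0 → lev v = 0 → u = v

theorem up_no_cross {V : Type} {G : SimpleGraph V} {lev : V → ℕ} (hG : ChordalBipartite G)
    (hl : IsLevel G lev) {s t w p q : V} (hst : lev s = lev t) (hsw : G.Adj s w)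
    (htw : G.Adj t w) (hw : lev w = lev s + 1) (hp : G.Adj s p) (hpl : lev p + 1 = lev s)
    (hq : G.Adj t q) (hql : lev q + 1 = lev t) (hpt : ¬ G.Adj t p) (hqs : ¬ G.Adj s q) :
    False := by
  have hpq : p ≠ q := fun h => hpt (h ▸ hq)
  have hpql : lev p = lev q := by omega
  have hnadj : ∀ a b, lev a = lev b → ¬ G.Adj a b := by
    intro a b hab h
    have := hl.adj a b h
    omega
  have hnadj2 : ∀ a b, lev a + 2 ≤ lev b → ¬ G.Adj b a := by
    intro a b hab h
    have := hl.adj b a h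
    omega
  let S : Set V := {v | lev v < lev p ∨ v = p ∨ v = q}
  let H := restr G S
  have hHG : H ≤ G := fun u v h => h.1
  have hSl : ∀ v ∈ S, lev v ≤ lev p := by
    rintro v (h | h | h)
    · omega
    · rw [h]
    · rw [h]; omega
  have hreach0 : ∀ j v, lev v = j → v ∈ S → ∃ z, lev z = 0 ∧ H.Reachable v z := by
    intro j
    induction j with
    | zero => exact fun v hv _ => ⟨v, hv, SimpleGraph.Reachable.refl _⟩
    | succ j ih =>
      intro v hv hvS
      obtain ⟨u, hu, hul⟩ := hl.down v (by omega)
      have huS : u ∈ S := Or.inl (by have := hSl v hvS; omega)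
      obtain ⟨z, hz, hr⟩ := ih u (by omega) huS
      have hvu : H.Adj v u := ⟨hu, hvS, huS⟩
      exact ⟨z, hz, hvu.reachable.trans hr⟩
  have hpS : p ∈ S := Or.inr (Or.inl rfl)
  have hqS : q ∈ S := Or.inr (Or.inr rfl)
  have hpqG : G.Reachable p q :=
    (hp.symm.reachable.trans hsw.reachable).trans (htw.symm.reachable.trans hq.reachable)
  have hreach : H.Reachable p q := by
    obtain ⟨z1, hz1, hr1⟩ := hreach0 _ p rfl hpS
    obtain ⟨z2, hz2, hr2⟩ := hreach0 _ q rfl hqS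
    have : z1 = z2 := hl.root _ _
      (((hr1.mono hHG).symm.trans hpqG).trans (hr2.mono hHG)) hz1 hz2
    subst this
    exact hr1.trans hr2.symm
  obtain ⟨P, hP⟩ := hreach.exists_walk_length_eq_dist
  set L := P.length with hL
  let c0 : ℕ → V := fun i => P.getVert i
  have hd1 : ∀ i, H.dist p (c0 i) ≤ i := by
    intro i
    refine (SimpleGraph.dist_le (P.take i)).trans ?_
    simp
  have hd2 : ∀ i, H.dist (c0 i) q ≤ L - i := by
    intro i
    refine (SimpleGraph.dist_le (P.drop i)).trans ?_
    simp [hL]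
  have hr1 : ∀ i, H.Reachable p (c0 i) := fun i => ⟨P.take i⟩
  have hc0 : c0 0 = p := by simp [c0]
  have hcL : c0 L = q := by simp [c0, hL]
  have hadj0 : ∀ i, i < L → H.Adj (c0 i) (c0 (i + 1)) := fun i hi => P.adj_getVert_succ hi
  have hdd : ∀ i j, L ≤ i + (H.dist (c0 i) (c0 j) + (L - j)) := by
    intro i j
    have h1 := (hr1 i).dist_triangle_left q
    have h2 := ((hr1 i).symm.trans (hr1 j)).dist_triangle_left q
    have := hd1 i
    have := hd2 j
    omega
  have hne0 : ∀ i j, i < j → j ≤ L → c0 i ≠ c0 j := by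
    intro i j hij hj h
    have := hdd i j
    rw [h, SimpleGraph.dist_self] at this
    omega
  have hLpos : L ≠ 0 := fun h => hpq (by rw [← hc0, ← hcL, h])
  have hmemS : ∀ i, i ≤ L → c0 i ∈ S := by
    intro i hi
    rcases Nat.lt_or_ge i L with h | h
    · exact (hadj0 i h).2.1
    · have : i = L := by omega
      rw [this, hcL]; exact hqS
  have hadjc0 : ∀ i j, i < j → j ≤ L → (G.Adj (c0 i) (c0 j) ↔ j = i + 1) := by
    intro i j hij hj
    constructor
    · intro h
      have hH : H.Adj (c0 i) (c0 j) := ⟨h, hmemS i (by omega), hmemS j hj⟩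
      have := hdd i j
      rw [SimpleGraph.dist_eq_one_iff_adj.mpr hH] at this
      omega
    · rintro rfl
      exact (hadj0 i (by omega)).1
  have hL1 : L ≠ 1 := by
    intro h
    have := (hadj0 0 (by omega)).1
    rw [hc0, zero_add, ← h, hcL] at this
    exact hnadj _ _ hpql this
  have hInter : ∀ i, 0 < i → i < L → lev (c0 i) < lev p := by
    intro i h0 hi
    rcases hmemS i hi.le with h | h | h
    · exact h
    · exact absurd (hc0.trans h.symm) (hne0 0 i h0 hi.le)
    · exact absurd (h.trans hcL.symm) (hne0 i L hi le_rfl)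
  have hlevS : ∀ i, i ≤ L → lev (c0 i) ≤ lev p := fun i hi => hSl _ (hmemS i hi)
  have hst' : s ≠ t := fun h => hpt (h ▸ hp)
  let c : ℕ → V := fun i => if i ≤ L then c0 i else if i = L + 1 then t
    else if i = L + 2 then w else s
  have e0 : ∀ i, i ≤ L → c i = c0 i := fun i hi => by simp [c, hi]
  have e1 : c (L + 1) = t := by simp [c]
  have e2 : c (L + 2) = w := by simp [c]
  have e3 : c (L + 3) = s := by simp [c]
  refine hG.2 (L + 4) (by omega) (cycle_embed G (L + 4) (by omega) c ?_ ?_)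
  · intro i j hij hj
    rcases Nat.lt_or_ge L j with h | h
    · have hj' : j = L + 1 ∨ j = L + 2 ∨ j = L + 3 := by omega
      rcases Nat.lt_or_ge L i with h' | h'
      · have hi' : i = L + 1 ∨ i = L + 2 := by omega
        rcases hi' with rfl | rfl <;> rcases hj' with rfl | rfl | rfl <;> try omega
        · rw [e1, e2]; exact htw.ne
        · rw [e1, e3]; exact hst'.symm
        · rw [e2, e3]; exact hsw.ne.symm
      · have hh := hlevS i h'
        rw [e0 i h']
        rcases hj' with rfl | rfl | rfl
        · rw [e1]; intro h; rw [h] at hh; omega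
        · rw [e2]; intro h; rw [h] at hh; omega
        · rw [e3]; intro h; rw [h] at hh; omega
    · rw [e0 i (by omega), e0 j h]
      exact hne0 i j hij h
  · intro i j hij hj
    rcases Nat.lt_or_ge L j with h | h
    · have hj' : j = L + 1 ∨ j = L + 2 ∨ j = L + 3 := by omega
      rcases Nat.lt_or_ge L i with h' | h'
      · have hi' : i = L + 1 ∨ i = L + 2 := by omega
        rcases hi' with rfl | rfl <;> rcases hj' with rfl | rfl | rfl <;> try omega
        · rw [e1, e2]; exact iff_of_true htw (by omega)
        · rw [e1, e3]; exact iff_of_false (hnadj _ _ hst.symm) (by omega)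
        · rw [e2, e3]; exact iff_of_true hsw.symm (by omega)
      · have hh := hlevS i h'
        rw [e0 i h']
        rcases hj' with rfl | rfl | rfl
        · rw [e1, G.adj_comm]
          rcases Nat.eq_or_lt_of_le h' with h2 | h2
          · rw [h2, hcL]; exact iff_of_true hq (by omega)
          · rcases Nat.eq_zero_or_pos i with h3 | h3
            · rw [h3, hc0]; exact iff_of_false hpt (by omega)
            · have := hInter i h3 h2
              exact iff_of_false (hnadj2 _ _ (by omega)) (by omega)
        · rw [e2, G.adj_comm]
          exact iff_of_false (hnadj2 _ _ (by omega)) (by omega)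
        · rw [e3, G.adj_comm]
          rcases Nat.eq_zero_or_pos i with h3 | h3
          · rw [h3, hc0]; exact iff_of_true hp (by omega)
          · rcases Nat.eq_or_lt_of_le h' with h2 | h2
            · rw [h2, hcL]; exact iff_of_false hqs (by omega)
            · have := hInter i h3 h2
              exact iff_of_false (hnadj2 _ _ (by omega)) (by omega)
    · rw [e0 i (by omega), e0 j h, hadjc0 i j hij h]
      omega

/-! ### Finding `D_k` -/

theorem find_D {V : Type} {G : SimpleGraph V} {lev : V → ℕ} (hl : IsLevel G lev)
    {k : ℕ} {s t w p g a : V} (b : Fin k ↪ V)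
    (hst : lev s = lev t) (hsw : G.Adj s w) (htw : G.Adj t w) (hw : lev w = lev s + 1)
    (hsp : G.Adj s p) (htp : G.Adj t p) (hpl : lev p + 1 = lev s)
    (hpg : G.Adj p g) (hgl : lev g + 1 = lev p)
    (hsa : G.Adj s a) (hal : lev a = lev s + 1) (hta : ¬ G.Adj t a)
    (htb : ∀ j, G.Adj t (b j)) (hbl : ∀ j, lev (b j) = lev s + 1)
    (hsb : ∀ j, ¬ G.Adj s (b j)) : Nonempty (Dgraph k ↪g G) := by
  have hnadj : ∀ a b, lev a = lev b → ¬ G.Adj a b := by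
    intro a b hab h
    have := hl.adj a b h
    omega
  have hnadj2 : ∀ a b, lev a + 2 ≤ lev b → ¬ G.Adj b a ∧ ¬ G.Adj a b := by
    intro a b hab
    constructor <;> intro h
    · have := hl.adj b a h
      omega
    · have := hl.adj a b h
      omega
  let φ : Fin 4 ⊕ (Fin 2 ⊕ Fin k) → V := fun x => match x with
    | Sum.inl 0 => p
    | Sum.inl 1 => s
    | Sum.inl 2 => w
    | Sum.inl 3 => t
    | Sum.inr (Sum.inl 0) => g
    | Sum.inr (Sum.inl 1) => a
    | Sum.inr (Sum.inr j) => b j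
  have f1 := hnadj2 g s (by omega)
  have f2 := hnadj2 g t (by omega)
  have f3 := hnadj2 g w (by omega)
  have f4 := hnadj2 g a (by omega)
  have f5 := fun j => hnadj2 g (b j) (by have := hbl j; omega)
  have f6 := hnadj2 p w (by omega)
  have f7 := hnadj2 p a (by omega)
  have f8 := fun j => hnadj2 p (b j) (by have := hbl j; omega)
  have f9 := hnadj s t hst
  have f10 := hnadj w a (by omega)
  have f11 := fun j => hnadj w (b j) (by have := hbl j; omega)
  have f12 := fun j => hnadj a (b j) (by have := hbl j; omega)
  have f13 := fun i j => hnadj (b i) (b j) (by have := hbl j; have := hbl i; omega)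
  have hadj : ∀ x y, (Dgraph k).Adj x y ↔ G.Adj (φ x) (φ y) := by
    have g1 : ¬ G.Adj a t := fun h => hta h.symm
    have g2 : ∀ j, ¬ G.Adj (b j) s := fun j h => hsb j h.symm
    have g3 : ¬ G.Adj t s := fun h => f9 h.symm
    have g4 : ¬ G.Adj a w := fun h => f10 h.symm
    have g5 : ∀ j, ¬ G.Adj (b j) w := fun j h => f11 j h.symm
    have g6 : ∀ j, ¬ G.Adj (b j) a := fun j h => f12 j h.symm
    have g7 : ∀ j, G.Adj (b j) t := fun j => (htb j).symm
    rintro (x | x | x) (y | y | y) <;> try fin_cases x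
    all_goals try fin_cases y
    all_goals simp [Dgraph, φ, hsw, htw, hsp, htp, hpg, hsa, hta, htb, hsb, f1, f2, f3, f4, f5,
      f6, f7, f8, f9, f10, f11, f12, f13, hsw.symm, htw.symm, hsp.symm, htp.symm, hpg.symm,
      hsa.symm, g1, g2, g3, g4, g5, g6, g7]
  have hinj : Function.Injective φ := by
    have hlne : ∀ x y, lev x ≠ lev y → x ≠ y := fun x y h h' => h (h' ▸ rfl)
    have n1 : s ≠ t := fun h => hta (h ▸ hsa)
    have n2 : w ≠ a := fun h => hta (h ▸ htw)
    have n3 : ∀ j, w ≠ b j := fun j h => hsb j (h ▸ hsw)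
    have n4 : ∀ j, a ≠ b j := fun j h => hsb j (h ▸ hsa)
    have m1 := hlne g p (by omega)
    have m2 := hlne g s (by omega)
    have m3 := hlne g t (by omega)
    have m4 := hlne g w (by omega)
    have m5 := hlne g a (by omega)
    have m6 := fun j => hlne g (b j) (by have := hbl j; omega)
    have m7 := hlne p s (by omega)
    have m8 := hlne p t (by omega)
    have m9 := hlne p w (by omega)
    have m10 := hlne p a (by omega)
    have m11 := fun j => hlne p (b j) (by have := hbl j; omega)
    have m12 := hsw.ne
    have m13 := hsa.ne
    have m14 := fun j => hlne s (b j) (by have := hbl j; omega)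
    have m15 := htw.ne
    have m16 := hlne t a (by omega)
    have m17 := fun j => hlne t (b j) (by have := hbl j; omega)
    rintro (x | x | x) (y | y | y) <;> try fin_cases x
    all_goals try fin_cases y
    all_goals simp [φ, n1, n2, n3, n4, m1, m2, m3, m4, m5, m6, m7, m8, m9, m10, m11, m12, m13,
      m14, m15, m16, m17, n1.symm, n2.symm, fun j => (n3 j).symm, fun j => (n4 j).symm, m1.symm, m2.symm, m3.symm,
      m4.symm, m5.symm, fun j => (m6 j).symm, m7.symm, m8.symm, m9.symm, m10.symm, fun j => (m11 j).symm, m12.symm,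
      m13.symm, fun j => (m14 j).symm, m15.symm, m16.symm, fun j => (m17 j).symm]
  exact ⟨⟨⟨φ, hinj⟩, fun {x y} => (hadj x y).symm⟩⟩

/-! ### Comparability in layers -/

open Classical in
noncomputable def downSet {V : Type} [Fintype V] (G : SimpleGraph V) (lev : V → ℕ) (s : V) :
    Finset V :=
  Finset.univ.filter (fun w => G.Adj s w ∧ lev w = lev s + 1)

theorem mem_downSet {V : Type} [Fintype V] (G : SimpleGraph V) (lev : V → ℕ) (s w : V) :
    w ∈ downSet G lev s ↔ G.Adj s w ∧ lev w = lev s + 1 := by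
  simp [downSet]

theorem up_comparable {V : Type} {G : SimpleGraph V} {lev : V → ℕ} (hG : ChordalBipartite G)
    (hl : IsLevel G lev) {s t w : V} (hst : lev s = lev t) (hsw : G.Adj s w)
    (htw : G.Adj t w) (hw : lev w = lev s + 1) :
    (∀ p, G.Adj s p → lev p + 1 = lev s → G.Adj t p) ∨
    (∀ p, G.Adj t p → lev p + 1 = lev t → G.Adj s p) := by
  by_contra hcon
  push Not at hcon
  obtain ⟨⟨p, hp1, hp2, hp3⟩, ⟨q, hq1, hq2, hq3⟩⟩ := hcon
  exact up_no_cross hG hl hst hsw htw hw hp1 hp2 hq1 hq2 hp3 hq3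

theorem down_comparable_aux {V : Type} [Fintype V] [DecidableEq V] {G : SimpleGraph V}
    {lev : V → ℕ} {k : ℕ}
    (hG : ChordalBipartite G) (hD : ¬ Nonempty (Dgraph k ↪g G))
    (hl : IsLevel G lev) {s t w : V} (hst : lev s = lev t) (h2 : 2 ≤ lev s) (hsw : G.Adj s w)
    (htw : G.Adj t w) (hw : lev w = lev s + 1) :
    downSet G lev s ⊆ downSet G lev t ∨ (downSet G lev t \ downSet G lev s).card < k := by
  by_contra hcon
  push Not at hcon
  obtain ⟨h1, h2'⟩ := hcon
  obtain ⟨a, ha1, ha2⟩ := Finset.not_subset.mp h1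
  obtain ⟨B, hB, hBc⟩ := Finset.exists_subset_card_eq h2'
  obtain ⟨p, hsp, htp, hpl⟩ : ∃ p, G.Adj s p ∧ G.Adj t p ∧ lev p + 1 = lev s := by
    rcases up_comparable hG hl hst hsw htw hw with h | h
    · obtain ⟨p, hp, hpl⟩ := hl.down s (by omega)
      exact ⟨p, hp, h p hp hpl, hpl⟩
    · obtain ⟨p, hp, hpl⟩ := hl.down t (by omega)
      exact ⟨p, h p hp hpl, hp, by omega⟩
  obtain ⟨g, hpg, hgl⟩ := hl.down p (by omega)
  rw [mem_downSet] at ha1 ha2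
  let b : Fin k ↪ V := ((finCongr hBc).symm.toEmbedding.trans
    B.equivFin.symm.toEmbedding).trans (Function.Embedding.subtype _)
  have hb : ∀ j, b j ∈ downSet G lev t \ downSet G lev s := fun j =>
    hB (B.equivFin.symm ((finCongr hBc).symm j)).2
  simp only [Finset.mem_sdiff, mem_downSet] at hb
  refine hD (find_D hl b hst hsw htw hw hsp htp hpl hpg hgl ha1.1 ha1.2 ?_ ?_ ?_ ?_)
  · exact fun h => ha2 ⟨h, by omega⟩
  · exact fun j => (hb j).1.1
  · exact fun j => by have := (hb j).1.2; omega
  · exact fun j h => (hb j).2 ⟨h, by have := (hb j).1.2; omega⟩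

theorem down_comparable {V : Type} [Fintype V] [DecidableEq V] {G : SimpleGraph V}
    {lev : V → ℕ} {k : ℕ}
    (hG : ChordalBipartite G) (hD : ¬ Nonempty (Dgraph k ↪g G))
    (hl : IsLevel G lev) {s t w : V} (hst : lev s = lev t) (h2 : 2 ≤ lev s) (hsw : G.Adj s w)
    (htw : G.Adj t w) (hw : lev w = lev s + 1) :
    downSet G lev s ⊆ downSet G lev t ∨ downSet G lev t ⊆ downSet G lev s ∨
    ((downSet G lev s \ downSet G lev t).card < k ∧
      (downSet G lev t \ downSet G lev s).card < k) := by
  have h1 := down_comparable_aux hG hD hl hst h2 hsw htw hw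
  have h3 := down_comparable_aux hG hD hl hst.symm (by omega) htw hsw (by omega)
  tauto

/-! ### Level functions from roots -/

theorem isLevel_dist {V : Type} {G : SimpleGraph V} (hc : G.Colorable 2)
    (ρ : G.ConnectedComponent → V) (hρ : ∀ c, G.connectedComponentMk (ρ c) = c) :
    IsLevel G (fun v => G.dist (ρ (G.connectedComponentMk v)) v) := by
  have hreach : ∀ v, G.Reachable (ρ (G.connectedComponentMk v)) v := fun v =>
    SimpleGraph.ConnectedComponent.exact (hρ _)
  let col : G.Coloring Bool := hc.toColoring (by simp)
  refine ⟨?_, ?_, ?_⟩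
  · intro u v huv
    have hcc : G.connectedComponentMk u = G.connectedComponentMk v :=
      SimpleGraph.ConnectedComponent.sound huv.reachable
    have h1 := hreach u
    have h2 := hreach v
    rw [hcc] at h1 ⊢
    set r := ρ (G.connectedComponentMk v)
    have hne : G.dist r u ≠ G.dist r v := by
      intro h
      obtain ⟨P, hP⟩ := h1.exists_walk_length_eq_dist
      obtain ⟨Q, hQ⟩ := h2.exists_walk_length_eq_dist
      have e1 := col.even_length_iff_congr P
      have e2 := col.even_length_iff_congr Q
      have e3 := col.valid huv
      rw [hP, h, ← hQ, e2] at e1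
      apply e3
      cases hcu : col u <;> cases hcv : col v <;> cases hcr : col r <;> simp_all
    have := h1.dist_triangle_left v
    have := h2.dist_triangle_left u
    have := SimpleGraph.dist_eq_one_iff_adj.mpr huv
    have := SimpleGraph.dist_eq_one_iff_adj.mpr huv.symm
    omega
  · intro v hv
    obtain ⟨P, hP⟩ := (hreach v).exists_walk_length_eq_dist
    have hlast := P.adj_getVert_succ (i := P.length - 1) (by omega)
    have : P.length - 1 + 1 = P.length := by omega
    rw [this, SimpleGraph.Walk.getVert_length] at hlast
    refine ⟨_, hlast.symm, ?_⟩
    have hcc : G.connectedComponentMk (P.getVert (P.length - 1)) = G.connectedComponentMk v :=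
      SimpleGraph.ConnectedComponent.sound hlast.reachable
    rw [hcc]
    change 0 < G.dist (ρ (G.connectedComponentMk v)) v at hv
    have h1 : G.dist (ρ (G.connectedComponentMk v)) (P.getVert (P.length - 1)) ≤ P.length - 1 := by
      refine (SimpleGraph.dist_le (P.take (P.length - 1))).trans ?_
      simp
    have h2 := ((hreach v).trans hlast.symm.reachable).dist_triangle_left v
    have := SimpleGraph.dist_eq_one_iff_adj.mpr hlast
    omega
  · intro u v huv hu hv
    have hcc : G.connectedComponentMk u = G.connectedComponentMk v :=
      SimpleGraph.ConnectedComponent.sound huv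
    rw [(hreach u).dist_eq_zero_iff] at hu
    rw [(hreach v).dist_eq_zero_iff] at hv
    rw [← hu, ← hv, hcc]

/-! ### The decomposition -/

theorem decomposition {V : Type} [Fintype V] [DecidableEq V] {G : SimpleGraph V} {k : ℕ}
    (hk : 1 ≤ k) (hG : ChordalBipartite G) (hD : ¬ Nonempty (Dgraph k ↪g G)) :
    ∃ F₁ F₂ : V → Finset V, AlmostLaminar k F₁ ∧ AlmostLaminar k F₂ ∧
      ∀ u v, G.Adj u v ↔ (v ∈ F₁ u ∨ v ∈ F₂ u) ∨ (u ∈ F₁ v ∨ u ∈ F₂ v) := by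
  classical
  let col : G.Coloring Bool := hG.1.toColoring (by simp)
  have hpair : ∀ c : G.ConnectedComponent, ∃ r x, G.connectedComponentMk r = c ∧
      G.connectedComponentMk x = c ∧ ∀ a b, G.connectedComponentMk a = c →
        G.connectedComponentMk b = c → G.dist a b ≤ G.dist r x := by
    intro c
    obtain ⟨v, hv⟩ := c.exists_rep
    obtain ⟨y, hy, hmax⟩ := (Finset.univ.filter (fun y : V × V =>
      G.connectedComponentMk y.1 = c ∧ G.connectedComponentMk y.2 = c)).exists_max_image
      (fun y => G.dist y.1 y.2) ⟨(v, v), by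
        have hv' : G.connectedComponentMk v = c := hv
        simp [hv']⟩
    simp only [Finset.mem_filter, Finset.mem_univ, true_and] at hy hmax
    exact ⟨y.1, y.2, hy.1, hy.2, fun a b ha hb => hmax (a, b) ⟨ha, hb⟩⟩
  choose r x hr hx hmax using hpair
  let mk := G.connectedComponentMk
  let lam : V → ℕ := fun v => G.dist (x (mk v)) v
  let mu : V → ℕ := fun v => G.dist (r (mk v)) v
  let m : V → ℕ := fun v => G.dist (r (mk v)) (x (mk v))
  have hlam : IsLevel G lam := isLevel_dist hG.1 x hx
  have hmu : IsLevel G mu := isLevel_dist hG.1 r hr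
  have hmk : ∀ u v, G.Adj u v → mk u = mk v := fun u v h =>
    SimpleGraph.ConnectedComponent.sound h.reachable
  have hlam1 : ∀ s, lam s = 1 → G.Adj s (x (mk s)) := fun s hs =>
    (SimpleGraph.dist_eq_one_iff_adj.mp hs).symm
  have hlamx : ∀ c, lam (x c) = 0 := by
    intro c
    simp only [lam, mk, hx, SimpleGraph.dist_self]
  have hmux : ∀ v, mu (x (mk v)) = m v := by
    intro v
    simp only [mu, m, mk, hx]
  have hmule : ∀ v, mu v ≤ m v := fun v => hmax (mk v) _ _ (hr _) rfl
  have hm : ∀ u v, mk u = mk v → m u = m v := fun u v h => by simp only [m, h]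
  -- neighbours of the root
  have hnx : ∀ s, lam s = 1 → mu s + 1 = m s := by
    intro s hs
    have h1 := hmu.adj _ _ (hlam1 s hs)
    rw [hmux] at h1
    have := hmule s
    omega
  -- small diameter
  have hsmall : ∀ s t w, lam s = 1 → lam t = 1 → mk s = mk t → m s ≤ 2 → G.Adj s w →
      G.Adj t w := by
    intro s t w hs ht hst hms hsw
    have h1 := hlam1 s hs
    have h2 := hlam1 t ht
    have c1 := col.valid h1
    have c2 := col.valid h2
    have c3 := col.valid hsw
    rw [hst] at c1
    have hd : G.dist t w ≤ 2 := (hmax (mk s) t w hst.symm (hmk _ _ hsw).symm).trans hms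
    have hre : G.Reachable t w := SimpleGraph.ConnectedComponent.exact
      (hst.symm.trans (hmk _ _ hsw))
    obtain ⟨P, hP⟩ := hre.exists_walk_length_eq_dist
    have e1 := col.even_length_iff_congr P
    have hodd : ¬ Even (G.dist t w) := by
      rw [← hP, e1]
      revert c1 c2 c3
      cases col s <;> cases col t <;> cases col w <;> cases col (x (mk t)) <;> simp
    rw [← SimpleGraph.dist_eq_one_iff_adj]
    have : G.dist t w ≠ 0 := fun h => hodd (by simp [h])
    have : G.dist t w ≠ 2 := fun h => hodd (by simp [h])
    omega
  let F₁ : V → Finset V := fun s => Finset.univ.filter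
    (fun w => G.Adj s w ∧ lam s = 1 ∧ lam w = 2 ∧ mu w + 2 = m w)
  let F₂ : V → Finset V := fun s => Finset.univ.filter
    (fun w => G.Adj s w ∧ lam w = lam s + 1 ∧ ¬ (lam s = 1 ∧ mu w + 2 = m w))
  have hF₁ : ∀ s w, w ∈ F₁ s ↔ G.Adj s w ∧ lam s = 1 ∧ lam w = 2 ∧ mu w + 2 = m w := by
    intro s w; simp [F₁]
  have hF₂ : ∀ s w, w ∈ F₂ s ↔ G.Adj s w ∧ lam w = lam s + 1 ∧
      ¬ (lam s = 1 ∧ mu w + 2 = m w) := by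
    intro s w; simp [F₂]
  refine ⟨F₁, F₂, ?_, ?_, ?_⟩
  · intro s t w hws hwt
    rw [hF₁] at hws hwt
    obtain ⟨hsw, hs1, hw2, hwm⟩ := hws
    obtain ⟨htw, ht1, -, -⟩ := hwt
    have hst : mk s = mk t := (hmk _ _ hsw).trans (hmk _ _ htw).symm
    have hms := hm _ _ hst
    rcases Nat.lt_or_ge 2 (m s) with h3 | h3
    · have a1 := hnx s hs1
      have a2 := hnx t ht1
      have b1 := hlam1 s hs1
      have b2 := hlam1 t ht1
      rw [← hst] at b2
      have a3 := hmux s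
      rcases up_comparable hG hmu (by omega) b1 b2 (by omega) with h | h
      · left
        intro v hv
        rw [hF₁] at hv ⊢
        have hmv := hm _ _ (hmk _ _ hv.1)
        exact ⟨h v hv.1 (by omega), ht1, hv.2.2⟩
      · right; left
        intro v hv
        rw [hF₁] at hv ⊢
        have hmv := hm _ _ (hmk _ _ hv.1)
        exact ⟨h v hv.1 (by omega), hs1, hv.2.2⟩
    · left
      intro v hv
      rw [hF₁] at hv ⊢
      exact ⟨hsmall s t v hs1 ht1 hst h3 hv.1, ht1, hv.2.2⟩
  · intro s t w hws hwt
    rw [hF₂] at hws hwt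
    obtain ⟨hsw, hsl, hwm⟩ := hws
    obtain ⟨htw, htl, hwm'⟩ := hwt
    have hst : mk s = mk t := (hmk _ _ hsw).trans (hmk _ _ htw).symm
    have hms := hm _ _ hst
    have hstl : lam s = lam t := by omega
    have hcases : lam s = 0 ∨ lam s = 1 ∨ 2 ≤ lam s := by omega
    rcases hcases with h0 | h1 | h2
    · have : s = t := hlam.root s t (hsw.reachable.trans htw.symm.reachable) h0 (by omega)
      left; rw [this]
    · have ht1 : lam t = 1 := by omega
      rcases Nat.lt_or_ge 2 (m s) with h3 | h3
      · have a1 := hnx s h1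
        have a2 := hnx t ht1
        have b1 := hlam1 s h1
        have b2 := hlam1 t ht1
        rw [← hst] at b2
        have a3 := hmux s
        have key : ∀ u, lam u = 1 → mk u = mk s →
            F₂ u = (downSet G mu u).erase (x (mk s)) := by
          intro u hu hus
          have hmu' := hnx u hu
          ext v
          rw [hF₂, Finset.mem_erase, mem_downSet]
          constructor
          · rintro ⟨q1, q2, q3⟩
            refine ⟨?_, q1, ?_⟩
            · rintro rfl
              rw [hlamx] at q2
              omega
            · have := hmu.adj _ _ q1
              have := hm _ _ (hmk _ _ q1)
              by_contra hne
              exact q3 ⟨hu, by omega⟩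
          · rintro ⟨q1, q2, q3⟩
            refine ⟨q2, ?_, ?_⟩
            · have := hlam.adj _ _ q2
              by_contra hne
              have hv0 : lam v = 0 := by omega
              refine q1 (hlam.root v _ ?_ hv0 (hlamx _))
              have b3 := hlam1 u hu
              rw [hus] at b3
              exact q2.symm.reachable.trans b3.reachable
            · have := hm _ _ (hmk _ _ q2)
              omega
        rw [key s h1 rfl, key t ht1 hst.symm]
        have hnot : x (mk s) ∈ downSet G mu s ∧ x (mk s) ∈ downSet G mu t := by
          rw [mem_downSet, mem_downSet]
          exact ⟨⟨b1, by omega⟩, ⟨b2, by omega⟩⟩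
        have hsub : ∀ A B : Finset V, (A.erase (x (mk s)) \ B.erase (x (mk s))).card ≤
            (A \ B).card := by
          intro A B
          apply Finset.card_le_card
          intro v hv
          simp only [Finset.mem_sdiff, Finset.mem_erase] at hv ⊢
          tauto
        rcases down_comparable hG hD hmu (s := s) (t := t) (by omega) (by omega) b1 b2
          (by omega) with h | h | h
        · left; exact Finset.erase_subset_erase _ h
        · right; left; exact Finset.erase_subset_erase _ h
        · right; right
          exact ⟨(hsub _ _).trans_lt h.1, (hsub _ _).trans_lt h.2⟩
      · left
        intro v hv
        rw [hF₂] at hv ⊢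
        exact ⟨hsmall s t v h1 ht1 hst h3 hv.1, by omega, fun h => hv.2.2 ⟨h1, h.2⟩⟩
    · have key : ∀ u, lam u = lam s → F₂ u = downSet G lam u := by
        intro u hu
        ext v
        rw [hF₂, mem_downSet]
        constructor
        · exact fun h => ⟨h.1, h.2.1⟩
        · exact fun h => ⟨h.1, h.2, fun h' => by omega⟩
      rw [key s rfl, key t hstl.symm]
      exact down_comparable hG hD hlam hstl h2 hsw htw hsl
  · have hstep : ∀ u v, G.Adj u v → lam v = lam u + 1 → v ∈ F₁ u ∨ v ∈ F₂ u := by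
      intro u v huv hl
      rw [hF₁, hF₂]
      by_cases h : lam u = 1 ∧ mu v + 2 = m v
      · exact Or.inl ⟨huv, h.1, by omega, h.2⟩
      · exact Or.inr ⟨huv, hl, h⟩
    intro u v
    constructor
    · intro huv
      rcases hlam.adj u v huv with h | h
      · exact Or.inr (hstep v u huv.symm h)
      · exact Or.inl (hstep u v huv h)
    · rintro ((h | h) | (h | h))
      · exact ((hF₁ _ _).mp h).1
      · exact ((hF₂ _ _).mp h).1
      · exact ((hF₁ _ _).mp h).1.symm
      · exact ((hF₂ _ _).mp h).1.symm

/-- For every `k ≥ 1`, the class of `D_k`-free chordal bipartite graphs admits an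
implicit representation. -/
theorem statement12 (k : ℕ) (hk : 1 ≤ k) :
    AdmitsImplicit (fun n G => ChordalBipartite G ∧ ¬ Nonempty (Dgraph k ↪g G)) := by
  refine admits_of_tuples (ι := Bool × (Fin 3 ⊕ Fin (2 * k)))
    (fun a b => (famRel k (fun i => a (false, i)) (fun i => b (false, i)) ∨
        famRel k (fun i => a (true, i)) (fun i => b (true, i))) ∨
      (famRel k (fun i => b (false, i)) (fun i => a (false, i)) ∨
        famRel k (fun i => b (true, i)) (fun i => a (true, i)))) _ ?_
  rintro n hn G ⟨hG, hD⟩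
  obtain ⟨F₁, F₂, h1, h2, hadj⟩ := decomposition hk hG hD
  obtain ⟨f₁, i1, l1, r1⟩ := almostLaminar_rep k F₁ h1
  obtain ⟨f₂, i2, l2, r2⟩ := almostLaminar_rep k F₂ h2
  refine ⟨fun u p => match p with
    | (false, i) => f₁ u i
    | (true, i) => f₂ u i, ?_, ?_, ?_⟩
  · intro u v huv
    apply i1
    funext i
    exact congrFun huv (false, i)
  · rintro u ⟨b, i⟩
    cases b
    · simpa using l1 u i
    · simpa using l2 u i
  · intro u v _
    rw [hadj, r1, r2, r1, r2]
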